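/- Let m = 2^k and n = 2m. Let T be a 2-regular data set over an n × n strategy space whose sign-pattern matrix equals the Sylvester Hadamard matrix H_m. Then every bimatrix game (A,B) that rationalizes T satisfies rank(A+B) ≥ √m. -/

import Mathlib

/-- An observation: an observed choice `(i,j)` together with a subgame `(I,J)`. -/
abbrev Obs (n : ℕ) := (Fin n × Fin n) × Finset (Fin n) × Finset (Fin n)

/-- `T` is a (well-formed) data set: each observed choice lies in its subgame. -/
def IsDataset {n : ℕ} (T : Finset (Obs n)) : Prop :=
  ∀ o ∈ T, o.1.1 ∈ o.2.1 ∧ o.1.2 ∈ o.2.2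

/-- `(i,j)` is a strict Nash equilibrium of the subgame `(I,J)` of the bimatrix game `(A,B)`:
`A i j > A i' j` for all other `i' ∈ I` and `B i j > B i j'` for all other `j' ∈ J`. -/
def StrictNash {n : ℕ} (A B : Matrix (Fin n) (Fin n) ℝ)
    (I J : Finset (Fin n)) (i j : Fin n) : Prop :=
  i ∈ I ∧ j ∈ J ∧ (∀ i' ∈ I, i' ≠ i → A i' j < A i j) ∧ (∀ j' ∈ J, j' ≠ j → B i j' < B i j)

/-- The bimatrix game `(A,B)` rationalizes the data set `T`: every observed choice is a
strict Nash equilibrium of its subgame. -/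
def Rationalizes {n : ℕ} (A B : Matrix (Fin n) (Fin n) ℝ) (T : Finset (Obs n)) : Prop :=
  ∀ o ∈ T, StrictNash A B o.2.1 o.2.2 o.1.1 o.1.2

/-- The data set `T` is rationalizable by some bimatrix game. -/
def Rationalizable {n : ℕ} (T : Finset (Obs n)) : Prop :=
  ∃ A B : Matrix (Fin n) (Fin n) ℝ, Rationalizes A B T

/-- The `t`-th element (`t ∈ {0,1}`) of the `a`-th pair of strategies in `[2m]`
(0-based; this is strategy `2a+1+t` in the 1-based numbering of the paper). -/
def dbl {m : ℕ} (a : Fin m) (t : Fin 2) : Fin (2 * m) :=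
  ⟨2 * a.1 + t.1, by have := a.isLt; have := t.isLt; omega⟩

/-- The `a`-th pair of strategies `{2a-1, 2a}` (1-based), as a subset of `[2m]`. -/
def pairF {m : ℕ} (a : Fin m) : Finset (Fin (2 * m)) := {dbl a 0, dbl a 1}

/-- A 2-regular data set: the subgames appearing in `T` are exactly the pairs
`(pairF a, pairF b)`, and for each such subgame the observed choices are exactly the two
diagonal profiles, or exactly the two off-diagonal profiles (but not both). -/
def TwoRegular {m : ℕ} (T : Finset (Obs (2 * m))) : Prop :=
  (∀ o ∈ T, ∃ a b : Fin m, o.2 = (pairF a, pairF b)) ∧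
  ∀ a b : Fin m,
    ({p : Fin (2 * m) × Fin (2 * m) | (p, pairF a, pairF b) ∈ T}
        = ({(dbl a 0, dbl b 0), (dbl a 1, dbl b 1)} : Set (Fin (2 * m) × Fin (2 * m)))) ∨
    ({p : Fin (2 * m) × Fin (2 * m) | (p, pairF a, pairF b) ∈ T}
        = ({(dbl a 0, dbl b 1), (dbl a 1, dbl b 0)} : Set (Fin (2 * m) × Fin (2 * m))))

/-- The Sylvester Hadamard matrix of order `2^k`: `H_1 = (1)` and
`H_{2m} = [[H_m, H_m], [H_m, -H_m]]`. -/
noncomputable def sylvester : (k : ℕ) → Matrix (Fin (2 ^ k)) (Fin (2 ^ k)) ℝ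
  | 0 => 1
  | (k + 1) =>
      Matrix.reindex (finSumFinEquiv.trans (finCongr (by ring : 2 ^ k + 2 ^ k = 2 ^ (k + 1))))
        (finSumFinEquiv.trans (finCongr (by ring : 2 ^ k + 2 ^ k = 2 ^ (k + 1))))
        (Matrix.fromBlocks (sylvester k) (sylvester k) (sylvester k) (-(sylvester k)))

open scoped Matrix

open Matrix in
/-- The derivative of `x ↦ det (1 + x M)` at `0` is the trace of `M`. -/
theorem hasDerivAt_det_one_add_smul {n : Type*} [Fintype n] [DecidableEq n] (M : Matrix n n ℝ) :
    HasDerivAt (fun x : ℝ => (1 + x • M).det) M.trace 0 := by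
  rw [funext fun x : ℝ => det_one_add_smul x M]
  generalize (det (1 + (Polynomial.X : Polynomial ℝ) • M.map Polynomial.C)).divX.divX = p
  have h1 := ((hasDerivAt_id (0 : ℝ)).const_mul M.trace).const_add 1
  have h2 := (p.hasDerivAt (0 : ℝ)).mul ((hasDerivAt_id (0 : ℝ)).pow 2)
  exact (h1.add h2).congr_deriv (by simp)

/-- A conical combination of positive definite matrices with some nonzero weight is positive
definite. -/
theorem Matrix.PosDef.sum_smul_of_nonneg {ι n : Type*} [Fintype ι] [Finite n]
    {U : ι → Matrix n n ℝ} (hU : ∀ i, (U i).PosDef) {c : ι → ℝ} (hc : ∀ i, 0 ≤ c i)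
    (hc' : ∃ i, 0 < c i) : (∑ i, c i • U i).PosDef := by
  classical
  obtain ⟨i, hi⟩ := hc'
  rw [← Finset.add_sum_erase _ _ (Finset.mem_univ i)]
  exact ((hU i).smul hi).add_posSemidef
    (Matrix.posSemidef_sum _ fun j _ => (hU j).posSemidef.smul (hc j))

open Matrix in
/-- Positive definite matrices `U i` admit positive weights `c i` for which
`c i * tr ((∑ j, c j U j)⁻¹ U i)` does not depend on `i`. -/
theorem exists_weights_trace_eq {ι n : Type*} [Fintype ι] [Nonempty ι] [Fintype n]
    [DecidableEq n] [Nonempty n] (U : ι → Matrix n n ℝ) (hU : ∀ i, (U i).PosDef) :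
    ∃ c : ι → ℝ, (∀ i, 0 < c i) ∧
      ∀ i, (Fintype.card ι : ℝ) * c i * ((∑ j, c j • U j)⁻¹ * U i).trace = Fintype.card n := by
  classical
  set r := Fintype.card n with hr
  set m := Fintype.card ι with hm
  have hr0 : r ≠ 0 := Fintype.card_ne_zero
  have hm0 : 0 < m := Fintype.card_pos
  let P : (ι → ℝ) → Matrix n n ℝ := fun c => ∑ j, c j • U j
  let F : (ι → ℝ) → ℝ := fun c => (∏ i, c i) ^ r
  let G : (ι → ℝ) → ℝ := fun c => (P c).det ^ m
  have hGpos : ∀ c : ι → ℝ, (∀ i, 0 ≤ c i) → (∃ i, 0 < c i) → 0 < G c := fun c h h' =>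
    pow_pos (Matrix.PosDef.sum_smul_of_nonneg hU h h').det_pos _
  have hex : ∀ c ∈ stdSimplex ℝ ι, ∃ i, 0 < c i := by
    intro c hc
    by_contra! h
    have := Finset.sum_nonpos fun i (_ : i ∈ Finset.univ) => h i
    linarith [hc.2]
  have hcont : ContinuousOn (fun c => F c / G c) (stdSimplex ℝ ι) := by
    refine ContinuousOn.div (by fun_prop) ?_ fun c hc => (hGpos c hc.1 (hex c hc)).ne'
    have : Continuous G := by
      refine Continuous.pow (Continuous.matrix_det ?_) _
      fun_prop
    exact this.continuousOn
  have hunif : (fun _ : ι => (m : ℝ)⁻¹) ∈ stdSimplex ℝ ι := by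
    refine ⟨fun _ => by positivity, ?_⟩
    simp [← hm, hm0.ne']
  obtain ⟨c, hc, hmax⟩ := (isCompact_stdSimplex ℝ ι).exists_isMaxOn ⟨_, hunif⟩ hcont
  have hGc := hGpos c hc.1 (hex c hc)
  have hFc : 0 < F c := by
    have h1 := hmax hunif
    have h2 : 0 < F (fun _ : ι => (m : ℝ)⁻¹) / G (fun _ : ι => (m : ℝ)⁻¹) :=
      div_pos (by positivity) (hGpos _ hunif.1 (hex _ hunif))
    have h3 : 0 < F c / G c := lt_of_lt_of_le h2 h1
    exact (div_pos_iff_of_pos_right hGc).1 h3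
  have hcpos : ∀ i, 0 < c i := by
    intro i
    refine lt_of_le_of_ne (hc.1 i) fun h => ?_
    have : ∏ i, c i = 0 := Finset.prod_eq_zero (Finset.mem_univ i) h.symm
    simp [F, this, hr0] at hFc
  have hglobal : ∀ d : ι → ℝ, (∀ i, 0 < d i) → F d / G d ≤ F c / G c := by
    intro d hd
    set s := ∑ i, d i with hs
    have hs0 : 0 < s := Finset.sum_pos (fun i _ => hd i) Finset.univ_nonempty
    have hmem : s⁻¹ • d ∈ stdSimplex ℝ ι := by
      refine ⟨fun i => mul_nonneg (by positivity) (hd i).le, ?_⟩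
      simp [← Finset.mul_sum, ← hs, hs0.ne']
    have h1 := hmax hmem
    have hF : F (s⁻¹ • d) = (s⁻¹) ^ (m * r) * F d := by
      simp [F, Finset.prod_mul_distrib, mul_pow, ← hm, pow_mul]
    have hP : P (s⁻¹ • d) = s⁻¹ • P d := by
      simp [P, Finset.smul_sum, mul_smul]
    have hG : G (s⁻¹ • d) = (s⁻¹) ^ (m * r) * G d := by
      simp only [G, hP, det_smul, mul_pow, ← hr, ← pow_mul]
      rw [mul_comm r m]
    have hne : (s⁻¹) ^ (m * r) ≠ 0 := by positivity
    simp only [Set.mem_ofPred_eq] at h1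
    rwa [hF, hG, mul_div_mul_left _ _ hne] at h1
  refine ⟨c, hcpos, fun i => ?_⟩
  have hPdet : IsUnit (P c).det :=
    (Matrix.PosDef.sum_smul_of_nonneg hU hc.1 (hex c hc)).det_pos.ne'.isUnit
  have hFx : ∀ x : ℝ, F (c + Pi.single i x) = F c * (1 + x / c i) ^ r := by
    intro x
    simp only [F, ← mul_pow]
    congr 1
    rw [← Finset.mul_prod_erase _ _ (Finset.mem_univ i),
      ← Finset.mul_prod_erase Finset.univ c (Finset.mem_univ i),
      Finset.prod_congr rfl fun j hj => show (c + Pi.single i x : ι → ℝ) j = c j by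
        simp [Finset.ne_of_mem_erase hj]]
    have := (hcpos i).ne'
    simp only [Pi.add_apply, Pi.single_eq_same]
    field_simp
  have hGx : ∀ x : ℝ, G (c + Pi.single i x) = G c * (1 + x • ((P c)⁻¹ * U i)).det ^ m := by
    intro x
    simp only [G, ← mul_pow, ← det_mul]
    congr 2
    rw [mul_add, mul_one, Matrix.mul_smul, mul_nonsing_inv_cancel_left _ _ hPdet]
    simp only [P, Pi.add_apply, add_smul, Finset.sum_add_distrib]
    congr 1
    rw [Finset.sum_eq_single i (fun j _ hj => by simp [hj]) (by simp)]
    simp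
  have hloc : IsLocalMax
      (fun x : ℝ => (1 + x / c i) ^ r - (1 + x • ((P c)⁻¹ * U i)).det ^ m) 0 := by
    have hev : ∀ᶠ x : ℝ in nhds 0, -c i < x := lt_mem_nhds (by simpa using hcpos i)
    filter_upwards [hev] with x hx
    have hd : ∀ j, 0 < (c + Pi.single i x : ι → ℝ) j := by
      intro j
      rcases eq_or_ne j i with rfl | hj
      · simp only [Pi.add_apply, Pi.single_eq_same]; linarith
      · simpa [hj] using hcpos j
    have h1 := hglobal _ hd
    rw [div_le_div_iff₀ (hGpos _ (fun j => (hd j).le) ⟨i, hd i⟩) hGc, hFx, hGx] at h1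
    have h2 : F c * G c * (1 + x / c i) ^ r
        ≤ F c * G c * (1 + x • ((P c)⁻¹ * U i)).det ^ m := by linarith
    have h3 := le_of_mul_le_mul_left h2 (mul_pos hFc hGc)
    simpa using h3
  have hder : HasDerivAt
      (fun x : ℝ => (1 + x / c i) ^ r - (1 + x • ((P c)⁻¹ * U i)).det ^ m)
      (r / c i - m * ((P c)⁻¹ * U i).trace) 0 := by
    have h1 := (((hasDerivAt_id (0 : ℝ)).div_const (c i)).const_add 1).pow r
    have h2 := (hasDerivAt_det_one_add_smul ((P c)⁻¹ * U i)).pow m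
    exact (h1.sub h2).congr_deriv (by simp [div_eq_mul_inv])
  have h0 := hloc.hasDerivAt_eq_zero hder
  have hci := (hcpos i).ne'
  change (m : ℝ) * c i * ((P c)⁻¹ * U i).trace = r
  field_simp at h0
  linarith

open Matrix in
/-- A weighted Cauchy–Schwarz inequality for the dual quadratic forms `P⁻¹` and `P`. -/
theorem Matrix.PosDef.two_mul_dotProduct_le {n : Type*} [Fintype n] [DecidableEq n]
    {P : Matrix n n ℝ} (hP : P.PosDef) (s : ℝ) (w y : n → ℝ) :
    2 * s * (w ⬝ᵥ y) ≤ s ^ 2 * (w ⬝ᵥ P⁻¹ *ᵥ w) + y ⬝ᵥ P *ᵥ y := by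
  have h := hP.posSemidef.dotProduct_mulVec_nonneg (y - s • (P⁻¹ *ᵥ w))
  have hu : IsUnit P.det := hP.det_pos.ne'.isUnit
  have hPT : Pᵀ = P := by simpa using hP.isHermitian.eq
  have h1 : P *ᵥ (P⁻¹ *ᵥ w) = w := by rw [mulVec_mulVec, mul_nonsing_inv _ hu, one_mulVec]
  have h2 : (P⁻¹ *ᵥ w) ⬝ᵥ (P *ᵥ y) = w ⬝ᵥ y := by
    rw [dotProduct_mulVec, ← mulVec_transpose, hPT, h1]
  simp only [star_trivial, mulVec_sub, mulVec_smul, h1, sub_dotProduct, dotProduct_sub,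
    smul_dotProduct, dotProduct_smul, h2, smul_eq_mul] at h
  rw [dotProduct_comm y w, dotProduct_comm (P⁻¹ *ᵥ w) w] at h
  nlinarith [h]

open Matrix in
/-- Every real matrix factors through a space of dimension its rank. -/
theorem Matrix.exists_eq_mul_rank {m n : Type*} [Fintype m] [Fintype n] (M : Matrix m n ℝ) :
    ∃ (X : Matrix m (Fin M.rank) ℝ) (Y : Matrix (Fin M.rank) n ℝ), M = X * Y := by
  classical
  have hfin : Module.finrank ℝ (LinearMap.range M.mulVecLin) = M.rank := rfl
  let b := Module.finBasisOfFinrankEq ℝ (LinearMap.range M.mulVecLin) hfin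
  let col : n → LinearMap.range M.mulVecLin := fun j =>
    ⟨M.mulVecLin (Pi.single j 1), LinearMap.mem_range_self _ _⟩
  refine ⟨Matrix.of fun i k => (b k : m → ℝ) i, Matrix.of fun k j => b.repr (col j) k, ?_⟩
  ext i j
  have h := congrArg (fun x : LinearMap.range M.mulVecLin => (x : m → ℝ) i) (b.sum_repr (col j))
  simp only [Submodule.coe_sum, Submodule.coe_smul, Finset.sum_apply, Pi.smul_apply,
    smul_eq_mul] at h
  have h' : ((col j : LinearMap.range M.mulVecLin) : m → ℝ) i = M i j := by simp [col]
  rw [h'] at h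
  simp only [mul_apply, of_apply]
  rw [← h]
  exact Finset.sum_congr rfl fun k _ => mul_comm _ _

open Matrix in
/-- **Forster's theorem** for Hadamard matrices: a realization of the sign pattern of a Hadamard
matrix of order `m` by inner products of vectors needs dimension at least `√m`. -/
theorem sqrt_card_le_of_hadamard_sign {ι n : Type*} [Fintype ι] [DecidableEq ι] [Nonempty ι]
    [Fintype n]
    (H : Matrix ι ι ℝ) (hH1 : ∀ i j, H i j = 1 ∨ H i j = -1)
    (hH2 : Hᵀ * H = (Fintype.card ι : ℝ) • (1 : Matrix ι ι ℝ))
    (u v : ι → n → ℝ) (huv : ∀ i j, 0 < H i j * (u i ⬝ᵥ v j)) :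
    √(Fintype.card ι : ℝ) ≤ Fintype.card n := by
  classical
  set m := Fintype.card ι with hm
  set r := Fintype.card n with hr
  have hm0 : (0 : ℝ) < m := by exact_mod_cast Fintype.card_pos (α := ι)
  have hne : ∀ i j, u i ⬝ᵥ v j ≠ 0 := fun i j h => by simpa [h] using huv i j
  have : Nonempty n := by
    by_contra hn
    rw [not_nonempty_iff] at hn
    obtain ⟨i⟩ := ‹Nonempty ι›
    exact hne i i (by simp [dotProduct])
  have hr0 : (0 : ℝ) < r := by exact_mod_cast Fintype.card_pos (α := n)
  suffices hη : ∀ η : ℝ, 0 < η → √(m : ℝ) ≤ (1 + η) * r by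
    refine le_of_forall_pos_le_add fun δ hδ => ?_
    have := hη (δ / r) (by positivity)
    rwa [add_mul, one_mul, div_mul_cancel₀ _ hr0.ne'] at this
  intro η hη
  obtain ⟨ε, hε, hεη⟩ : ∃ ε : ℝ, 0 < ε ∧
      ∀ i j, ε * (v j ⬝ᵥ v j) ≤ η * (u i ⬝ᵥ v j) ^ 2 := by
    have hev : ∀ p : ι × ι, ∀ᶠ ε : ℝ in nhdsWithin 0 (Set.Ioi 0),
        ε * (v p.2 ⬝ᵥ v p.2) ≤ η * (u p.1 ⬝ᵥ v p.2) ^ 2 := by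
      intro p
      refine Filter.Eventually.filter_mono nhdsWithin_le_nhds ?_
      have hcont : ContinuousAt (fun ε : ℝ => ε * (v p.2 ⬝ᵥ v p.2)) 0 := by fun_prop
      have hpos : 0 < η * (u p.1 ⬝ᵥ v p.2) ^ 2 :=
        mul_pos hη (sq_pos_of_ne_zero (hne p.1 p.2))
      exact (hcont.eventually (gt_mem_nhds (by simpa using hpos))).mono fun _ h => h.le
    obtain ⟨ε, h1, h2⟩ := ((Filter.eventually_all.2 hev).and self_mem_nhdsWithin).exists
    exact ⟨ε, h2, fun i j => h1 (i, j)⟩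
  let U : ι → Matrix n n ℝ := fun i => vecMulVec (u i) (u i) + ε • 1
  have hU : ∀ i, (U i).PosDef := fun i => by
    have h1 := posSemidef_vecMulVec_self_star (u i)
    rw [star_trivial] at h1
    exact PosDef.posSemidef_add h1 (PosDef.one.smul hε)
  obtain ⟨c, hc, hct⟩ := exists_weights_trace_eq U hU
  set P := ∑ j, c j • U j with hPdef
  have hP : P.PosDef := PosDef.sum_smul_of_nonneg hU (fun i => (hc i).le)
    (‹Nonempty ι›.elim fun i => ⟨i, hc i⟩)
  let t : ι → ℝ := fun i => (P⁻¹ * U i).trace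
  let q : ι → ℝ := fun j => v j ⬝ᵥ P *ᵥ v j
  have ht : ∀ i, 0 < t i := fun i => by
    have h := hct i
    have h2 : 0 < (m : ℝ) * c i := mul_pos hm0 (hc i)
    exact (pos_iff_pos_of_mul_pos (h ▸ hr0)).1 h2
  have hut : ∀ i, u i ⬝ᵥ P⁻¹ *ᵥ u i ≤ t i := fun i => by
    have h1 : t i = u i ⬝ᵥ P⁻¹ *ᵥ u i + ε * (P⁻¹).trace := by
      simp only [t, U, mul_add, trace_add, Matrix.mul_smul, mul_one, trace_smul, smul_eq_mul,
        mul_vecMulVec, trace_vecMulVec]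
      rw [dotProduct_comm]
    have h2 := hP.inv.posSemidef.trace_nonneg
    nlinarith
  have hq : ∀ j, 0 < q j := fun j => by
    have hv : v j ≠ 0 := fun h => hne j j (by simp [h])
    simpa using hP.dotProduct_mulVec_pos hv
  have hqle : ∀ j, q j ≤ (1 + η) * ∑ i, c i * (u i ⬝ᵥ v j) ^ 2 := fun j => by
    have h1 : q j = ∑ i, c i * ((u i ⬝ᵥ v j) ^ 2 + ε * (v j ⬝ᵥ v j)) := by
      simp only [q, hPdef, sum_mulVec, dotProduct_sum, smul_mulVec, dotProduct_smul, U,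
        add_mulVec, one_mulVec, dotProduct_add, vecMulVec_mulVec, smul_eq_mul]
      refine Finset.sum_congr rfl fun i _ => ?_
      simp only [op_smul_eq_smul, smul_eq_mul, dotProduct_comm (v j) (u i)]
      ring
    rw [h1, Finset.mul_sum]
    refine Finset.sum_le_sum fun i _ => ?_
    have := mul_le_mul_of_nonneg_left (hεη i j) (hc i).le
    linarith
  let w : ι → n → ℝ := fun i => (√(t i))⁻¹ • u i
  let z : ι → n → ℝ := fun j => (√(q j))⁻¹ • v j
  have hw : ∀ i, w i ⬝ᵥ P⁻¹ *ᵥ w i ≤ 1 := fun i => by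
    simp only [w, mulVec_smul, dotProduct_smul, smul_dotProduct, smul_eq_mul]
    rw [← mul_assoc, ← mul_inv, Real.mul_self_sqrt (ht i).le, inv_mul_le_iff₀ (ht i), mul_one]
    exact hut i
  have hz : ∀ j, z j ⬝ᵥ P *ᵥ z j = 1 := fun j => by
    simp only [z, mulVec_smul, dotProduct_smul, smul_dotProduct, smul_eq_mul]
    rw [← mul_assoc, ← mul_inv, Real.mul_self_sqrt (hq j).le]
    exact inv_mul_cancel₀ (hq j).ne'
  have hb : ∀ i j, w i ⬝ᵥ z j = (√(t i))⁻¹ * (√(q j))⁻¹ * (u i ⬝ᵥ v j) := fun i j => by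
    simp only [w, z, dotProduct_smul, smul_dotProduct, smul_eq_mul]
    ring
  have hb2 : ∀ i j, (w i ⬝ᵥ z j) ^ 2 = (u i ⬝ᵥ v j) ^ 2 / (t i * q j) := fun i j => by
    rw [hb, mul_pow, mul_pow, inv_pow, inv_pow, Real.sq_sqrt (ht i).le, Real.sq_sqrt (hq j).le]
    field_simp
  have hsq : ∀ i j, (w i ⬝ᵥ z j) ^ 2 ≤ H i j * (w i ⬝ᵥ z j) := fun i j => by
    have h1 := hP.two_mul_dotProduct_le 1 (w i) (z j)
    have h2 := hP.two_mul_dotProduct_le (-1) (w i) (z j)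
    rw [hz] at h1 h2
    have h3 := hw i
    have h4 : 0 < H i j * (w i ⬝ᵥ z j) := by
      rw [hb]
      have h5 : 0 < (√(t i))⁻¹ * (√(q j))⁻¹ :=
        mul_pos (inv_pos.2 (Real.sqrt_pos.2 (ht i))) (inv_pos.2 (Real.sqrt_pos.2 (hq j)))
      have := mul_pos h5 (huv i j)
      linarith
    rcases hH1 i j with h | h <;> rw [h] at h4 ⊢ <;> nlinarith
  have hcol : ∀ j, (m : ℝ) ≤ (1 + η) * r * ∑ i, H i j * (w i ⬝ᵥ z j) := fun j => by
    have h1 : (m : ℝ) * ((1 + η) * ∑ i, c i * (u i ⬝ᵥ v j) ^ 2)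
        = q j * ((1 + η) * r * ∑ i, (w i ⬝ᵥ z j) ^ 2) := by
      simp only [hb2, Finset.mul_sum]
      refine Finset.sum_congr rfl fun i _ => ?_
      have h2 : (m : ℝ) * c i * t i = r := hct i
      have h3 := (ht i).ne'
      have h4 := (hq j).ne'
      rw [← h2]
      field_simp
    have h5 : q j * m ≤ q j * ((1 + η) * r * ∑ i, (w i ⬝ᵥ z j) ^ 2) := by
      rw [← h1, mul_comm]
      exact mul_le_mul_of_nonneg_left (hqle j) hm0.le
    refine (le_of_mul_le_mul_left h5 (hq j)).trans ?_
    exact mul_le_mul_of_nonneg_left (Finset.sum_le_sum fun i _ => hsq i j) (by positivity)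
  set S := ∑ j, ∑ i, H i j * (w i ⬝ᵥ z j) with hS
  have hlow : (m : ℝ) * m ≤ (1 + η) * r * S := by
    have := Finset.sum_le_sum fun j (_ : j ∈ Finset.univ) => hcol j
    simpa [← Finset.mul_sum, ← hm] using this
  let y : ι → n → ℝ := fun i => ∑ j, H i j • z j
  have hy : ∑ i, y i ⬝ᵥ P *ᵥ y i = (m : ℝ) * m := by
    have hHH : ∀ j k, ∑ i, H i j * H i k = if j = k then (m : ℝ) else 0 := fun j k => by
      have := congrFun (congrFun hH2 j) k
      simpa [mul_apply, one_apply] using this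
    calc ∑ i, y i ⬝ᵥ P *ᵥ y i
        = ∑ i, ∑ j, ∑ k, H i j * H i k * (z j ⬝ᵥ P *ᵥ z k) := by
          refine Finset.sum_congr rfl fun i _ => ?_
          simp only [y, mulVec_sum, mulVec_smul, sum_dotProduct, dotProduct_sum, smul_dotProduct,
            dotProduct_smul, smul_eq_mul]
          simp only [Finset.mul_sum]
          rw [Finset.sum_comm]
          refine Finset.sum_congr rfl fun j _ => Finset.sum_congr rfl fun k _ => ?_
          ring
      _ = ∑ j, ∑ k, (∑ i, H i j * H i k) * (z j ⬝ᵥ P *ᵥ z k) := by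
          rw [Finset.sum_comm]
          refine Finset.sum_congr rfl fun j _ => ?_
          rw [Finset.sum_comm]
          exact Finset.sum_congr rfl fun k _ => (Finset.sum_mul _ _ _).symm
      _ = (m : ℝ) * m := by simp [hHH, hz, ← hm]
  have hup : √(m : ℝ) * S ≤ m * m := by
    have hSy : S = ∑ i, w i ⬝ᵥ y i := by
      rw [hS, Finset.sum_comm]
      simp [y, dotProduct_sum, dotProduct_smul]
    have h1 : ∀ i, 2 * √(m : ℝ) * (w i ⬝ᵥ y i) ≤ m + y i ⬝ᵥ P *ᵥ y i := fun i => by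
      have h2 := hP.two_mul_dotProduct_le √(m : ℝ) (w i) (y i)
      rw [Real.sq_sqrt hm0.le] at h2
      nlinarith [hw i]
    have h3 := Finset.sum_le_sum fun i (_ : i ∈ Finset.univ) => h1 i
    rw [← Finset.mul_sum, ← hSy, Finset.sum_add_distrib, hy] at h3
    simp only [Finset.sum_const, Finset.card_univ, ← hm, nsmul_eq_mul] at h3
    linarith
  have hfin : (m : ℝ) * m * √(m : ℝ) ≤ m * m * ((1 + η) * r) := by
    calc (m : ℝ) * m * √(m : ℝ) ≤ (1 + η) * r * S * √(m : ℝ) :=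
          mul_le_mul_of_nonneg_right hlow (Real.sqrt_nonneg _)
      _ = (1 + η) * r * (√(m : ℝ) * S) := by ring
      _ ≤ (1 + η) * r * (m * m) := mul_le_mul_of_nonneg_left hup (by positivity)
      _ = m * m * ((1 + η) * r) := by ring
  exact le_of_mul_le_mul_left hfin (by positivity)

/-- The entries of a Sylvester matrix are `±1`. -/
theorem sylvester_apply_eq (k : ℕ) (a b : Fin (2 ^ k)) :
    sylvester k a b = 1 ∨ sylvester k a b = -1 := by
  induction k with
  | zero =>
    have : Subsingleton (Fin (2 ^ 0)) := inferInstanceAs (Subsingleton (Fin 1))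
    left; rw [Subsingleton.elim a b]; simp [sylvester]
  | succ k ih =>
    simp only [sylvester, Matrix.reindex_apply, Matrix.submatrix_apply]
    generalize (finSumFinEquiv.trans (finCongr _)).symm a = a'
    generalize (finSumFinEquiv.trans (finCongr _)).symm b = b'
    rcases a' with a' | a' <;> rcases b' with b' | b' <;> simp [ih, neg_eq_iff_eq_neg, or_comm]

open Matrix in
/-- The columns of a Sylvester matrix of order `2 ^ k` are orthogonal of squared norm `2 ^ k`. -/
theorem sylvester_transpose_mul_self (k : ℕ) :
    (sylvester k)ᵀ * sylvester k = (2 ^ k : ℝ) • (1 : Matrix (Fin (2 ^ k)) (Fin (2 ^ k)) ℝ) := by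
  induction k with
  | zero => simp [sylvester]
  | succ k ih =>
    simp only [sylvester, reindex_apply, transpose_submatrix, submatrix_mul_equiv,
      fromBlocks_transpose, fromBlocks_multiply, transpose_neg, Matrix.mul_neg, Matrix.neg_mul,
      neg_neg, ih, add_neg_cancel]
    have h : (2 ^ k : ℝ) • (1 : Matrix (Fin (2 ^ k)) (Fin (2 ^ k)) ℝ) + (2 ^ k : ℝ) • 1
        = (2 ^ (k + 1) : ℝ) • 1 := by
      rw [← add_smul, pow_succ, mul_two]
    have h0 : (0 : Matrix (Fin (2 ^ k)) (Fin (2 ^ k)) ℝ) = (2 ^ (k + 1) : ℝ) • 0 :=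
      (smul_zero _).symm
    rw [h, h0, ← fromBlocks_smul, fromBlocks_one]
    rw [submatrix_smul, Pi.smul_apply, Pi.smul_apply, submatrix_one_equiv]

/-- Let `m = 2^k` and `n = 2m`. If `T` is a 2-regular data set over an
`n × n` strategy space whose sign-pattern matrix equals the Sylvester Hadamard matrix
`H_m` (i.e. the diagonal profiles are observed in subgame `(a,b)` when `(H_m) a b = 1`,
and the off-diagonal profiles when `(H_m) a b = -1`), then every bimatrix game `(A,B)`
that rationalizes `T` satisfies `rank (A+B) ≥ √m`. -/
theorem hadamard_dataset_high_rank (k : ℕ) (T : Finset (Obs (2 * 2 ^ k)))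
    (hT : IsDataset T) (h2reg : TwoRegular T)
    (hsign : ∀ a b : Fin (2 ^ k),
      (sylvester k a b = 1 →
        {p : Fin (2 * 2 ^ k) × Fin (2 * 2 ^ k) | (p, pairF a, pairF b) ∈ T}
          = ({(dbl a 0, dbl b 0), (dbl a 1, dbl b 1)} :
              Set (Fin (2 * 2 ^ k) × Fin (2 * 2 ^ k)))) ∧
      (sylvester k a b = -1 →
        {p : Fin (2 * 2 ^ k) × Fin (2 * 2 ^ k) | (p, pairF a, pairF b) ∈ T}
          = ({(dbl a 0, dbl b 1), (dbl a 1, dbl b 0)} :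
              Set (Fin (2 * 2 ^ k) × Fin (2 * 2 ^ k)))))
    (A B : Matrix (Fin (2 * 2 ^ k)) (Fin (2 * 2 ^ k)) ℝ) (hr : Rationalizes A B T) :
    Real.sqrt ((2 ^ k : ℕ) : ℝ) ≤ ((A + B).rank : ℝ) := by
  obtain ⟨X, Y, hXY⟩ := (A + B).exists_eq_mul_rank
  have hpair0 : ∀ a : Fin (2 ^ k), dbl a 0 ∈ pairF a := fun a => by simp [pairF]
  have hpair1 : ∀ a : Fin (2 ^ k), dbl a 1 ∈ pairF a := fun a => by simp [pairF]
  have hdbl : ∀ a : Fin (2 ^ k), dbl a 0 ≠ dbl a 1 := fun a h => by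
    simpa [dbl] using congrArg Fin.val h
  have key : ∀ a b, 0 < sylvester k a b *
      ((X (dbl a 0) - X (dbl a 1)) ⬝ᵥ (Yᵀ (dbl b 0) - Yᵀ (dbl b 1))) := by
    intro a b
    have hval : (X (dbl a 0) - X (dbl a 1)) ⬝ᵥ (Yᵀ (dbl b 0) - Yᵀ (dbl b 1))
        = (A + B) (dbl a 0) (dbl b 0) - (A + B) (dbl a 0) (dbl b 1)
          - (A + B) (dbl a 1) (dbl b 0) + (A + B) (dbl a 1) (dbl b 1) := by
      have hent : ∀ i j, (A + B) i j = X i ⬝ᵥ Yᵀ j := fun i j => by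
        conv_lhs => rw [hXY]
        rfl
      simp only [hent, sub_dotProduct, dotProduct_sub]
      ring
    rw [hval]
    simp only [Matrix.add_apply]
    rcases sylvester_apply_eq k a b with h | h
    · have hs := (hsign a b).1 h
      have m1 : ((dbl a 0, dbl b 0), pairF a, pairF b) ∈ T := by
        have : (dbl a 0, dbl b 0) ∈ {p | (p, pairF a, pairF b) ∈ T} := by rw [hs]; simp
        exact this
      have m2 : ((dbl a 1, dbl b 1), pairF a, pairF b) ∈ T := by
        have : (dbl a 1, dbl b 1) ∈ {p | (p, pairF a, pairF b) ∈ T} := by rw [hs]; simp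
        exact this
      obtain ⟨-, -, p1, p2⟩ := hr _ m1
      obtain ⟨-, -, p3, p4⟩ := hr _ m2
      have e1 := p1 _ (hpair1 a) (hdbl a).symm
      have e2 := p2 _ (hpair1 b) (hdbl b).symm
      have e3 := p3 _ (hpair0 a) (hdbl a)
      have e4 := p4 _ (hpair0 b) (hdbl b)
      dsimp only at e1 e2 e3 e4
      rw [h]; linarith
    · have hs := (hsign a b).2 h
      have m1 : ((dbl a 0, dbl b 1), pairF a, pairF b) ∈ T := by
        have : (dbl a 0, dbl b 1) ∈ {p | (p, pairF a, pairF b) ∈ T} := by rw [hs]; simp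
        exact this
      have m2 : ((dbl a 1, dbl b 0), pairF a, pairF b) ∈ T := by
        have : (dbl a 1, dbl b 0) ∈ {p | (p, pairF a, pairF b) ∈ T} := by rw [hs]; simp
        exact this
      obtain ⟨-, -, p1, p2⟩ := hr _ m1
      obtain ⟨-, -, p3, p4⟩ := hr _ m2
      have e1 := p1 _ (hpair1 a) (hdbl a).symm
      have e2 := p2 _ (hpair0 b) (hdbl b)
      have e3 := p3 _ (hpair0 a) (hdbl a)
      have e4 := p4 _ (hpair1 b) (hdbl b).symm
      dsimp only at e1 e2 e3 e4
      rw [h]; linarith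
  have h := sqrt_card_le_of_hadamard_sign (sylvester k) (sylvester_apply_eq k)
    (by rw [sylvester_transpose_mul_self]; simp) _ _ key
  simpa using h
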